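/- arXiv:1011.1839 — 2 statements merged into one kernel-verified Lean document; each statement's English description precedes it below -/
import Mathlib

section
/- Let A be a nonzero entrywise nonnegative m×n real matrix and θ > 1. Then every optimal solution of the problem: maximize ⟨A,X⟩ subject to ‖X‖_θ ≤ 1, is entrywise nonnegative. -/
open scoped BigOperators

noncomputable section

namespace LAROS

variable {m n : ℕ}

/-- Trace inner product `⟨A,X⟩ = trace(Aᵀ X)`. -/
def mInner (A X : Matrix (Fin m) (Fin n) ℝ) : ℝ := ∑ i, ∑ j, A i j * X i j

/-- `N` is a norm on `m×n` real matrices. -/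
def IsMatrixNorm (N : Matrix (Fin m) (Fin n) ℝ → ℝ) : Prop :=
  (∀ X, N X = 0 ↔ X = 0) ∧ (∀ (c : ℝ) (X), N (c • X) = |c| * N X) ∧
    (∀ X Y, N (X + Y) ≤ N X + N Y)

/-- Dual norm of `N`. -/
def dualNorm (N : Matrix (Fin m) (Fin n) ℝ → ℝ) (A : Matrix (Fin m) (Fin n) ℝ) : ℝ :=
  sSup {r | ∃ Y, N Y ≤ 1 ∧ r = mInner A Y}

/-- `X` is optimal for: minimize `N X` subject to `⟨A,X⟩ ≥ 1`. -/
def IsOptMin (N : Matrix (Fin m) (Fin n) ℝ → ℝ) (A X : Matrix (Fin m) (Fin n) ℝ) : Prop :=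
  1 ≤ mInner A X ∧ ∀ X', 1 ≤ mInner A X' → N X ≤ N X'

/-- `Y` is optimal for: maximize `⟨A,Y⟩` subject to `N Y ≤ 1`. -/
def IsOptMax (N : Matrix (Fin m) (Fin n) ℝ → ℝ) (A Y : Matrix (Fin m) (Fin n) ℝ) : Prop :=
  N Y ≤ 1 ∧ ∀ Y', N Y' ≤ 1 → mInner A Y' ≤ mInner A Y

/-- Subdifferential of `f : ℝ^{m×n} → ℝ` at `A`, with respect to the trace inner product. -/
def subdiff (f : Matrix (Fin m) (Fin n) ℝ → ℝ) (A : Matrix (Fin m) (Fin n) ℝ) :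
    Set (Matrix (Fin m) (Fin n) ℝ) :=
  {Y | ∀ B, f A + mInner (B - A) Y ≤ f B}

/-- The spectral norm (largest singular value) of an `m×n` real matrix. -/
def spectralNorm (A : Matrix (Fin m) (Fin n) ℝ) : ℝ :=
  sSup {r | ∃ (u : Fin m → ℝ) (v : Fin n → ℝ),
    (∑ i, u i ^ 2) ≤ 1 ∧ (∑ j, v j ^ 2) ≤ 1 ∧ r = ∑ i, ∑ j, u i * A i j * v j}

/-- The nuclear norm (sum of singular values), as the dual norm of the spectral norm. -/
def nuclearNorm (A : Matrix (Fin m) (Fin n) ℝ) : ℝ := dualNorm spectralNorm A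

/-- Entrywise ℓ1 norm: sum of absolute values of all entries. -/
def l1Norm (X : Matrix (Fin m) (Fin n) ℝ) : ℝ := ∑ i, ∑ j, |X i j|

/-- Entrywise max norm: maximum absolute value of an entry. -/
def maxNorm (X : Matrix (Fin m) (Fin n) ℝ) : ℝ := sSup {r | ∃ i j, r = |X i j|}

/-- The norm `‖X‖_θ = ‖X‖_* + θ‖X‖₁`. -/
def thetaNorm (θ : ℝ) (X : Matrix (Fin m) (Fin n) ℝ) : ℝ := nuclearNorm X + θ * l1Norm X

/-- Every value of the bilinear form over the unit balls is at most the spectral norm. -/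
theorem le_spectralNorm (Y : Matrix (Fin m) (Fin n) ℝ) {u : Fin m → ℝ} {v : Fin n → ℝ}
    (hu : ∑ i, u i ^ 2 ≤ 1) (hv : ∑ j, v j ^ 2 ≤ 1) :
    ∑ i, ∑ j, u i * Y i j * v j ≤ spectralNorm Y := by
  refine le_csSup ⟨l1Norm Y, ?_⟩ ⟨u, v, hu, hv, rfl⟩
  rintro r ⟨u, v, hu, hv, rfl⟩
  refine Finset.sum_le_sum fun i _ => Finset.sum_le_sum fun j _ => ?_
  have hui : |u i| ≤ 1 := by
    have h := Finset.single_le_sum (f := fun i => u i ^ 2) (fun k _ => sq_nonneg (u k))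
      (Finset.mem_univ i)
    exact (sq_le_one_iff_abs_le_one _).1 (h.trans hu)
  have hvj : |v j| ≤ 1 := by
    have h := Finset.single_le_sum (f := fun j => v j ^ 2) (fun k _ => sq_nonneg (v k))
      (Finset.mem_univ j)
    exact (sq_le_one_iff_abs_le_one _).1 (h.trans hv)
  calc u i * Y i j * v j ≤ |u i * Y i j * v j| := le_abs_self _
    _ = |u i| * |Y i j| * |v j| := by rw [abs_mul, abs_mul]
    _ ≤ 1 * |Y i j| * 1 := by gcongr
    _ = |Y i j| := by ring

/-- Every entry is bounded in absolute value by the spectral norm. -/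
theorem abs_apply_le_spectralNorm (Y : Matrix (Fin m) (Fin n) ℝ) (k : Fin m) (l : Fin n) :
    |Y k l| ≤ spectralNorm Y := by
  have key : ∀ c : ℝ, c ^ 2 ≤ 1 → c * Y k l ≤ spectralNorm Y := by
    intro c hc
    have h := le_spectralNorm Y (u := Pi.single k c) (v := Pi.single l 1)
      (by simpa [Pi.single_apply, ite_pow] using hc) (by simp [Pi.single_apply, ite_pow])
    simpa [Pi.single_apply, ite_mul, mul_ite] using h
  have h₁ := key 1 (by norm_num)
  have h₂ := key (-1) (by norm_num)
  exact abs_le'.2 ⟨by linarith, by linarith⟩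

theorem spectralNorm_zero_le : spectralNorm (0 : Matrix (Fin m) (Fin n) ℝ) ≤ 1 := by
  refine csSup_le ⟨_, 0, 0, by simp, by simp, rfl⟩ ?_
  rintro r ⟨u, v, -, -, rfl⟩
  simp

theorem mInner_le_nuclearNorm (X : Matrix (Fin m) (Fin n) ℝ) {Y : Matrix (Fin m) (Fin n) ℝ}
    (hY : spectralNorm Y ≤ 1) : mInner X Y ≤ nuclearNorm X := by
  refine le_csSup ⟨l1Norm X, ?_⟩ ⟨Y, hY, rfl⟩
  rintro r ⟨Z, hZ, rfl⟩
  refine Finset.sum_le_sum fun i _ => Finset.sum_le_sum fun j _ => ?_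
  calc X i j * Z i j ≤ |X i j * Z i j| := le_abs_self _
    _ = |X i j| * |Z i j| := abs_mul _ _
    _ ≤ |X i j| * 1 := by gcongr; exact (abs_apply_le_spectralNorm Z i j).trans hZ
    _ = |X i j| := mul_one _

theorem mInner_comm (X Y : Matrix (Fin m) (Fin n) ℝ) : mInner X Y = mInner Y X := by
  simp only [mInner, mul_comm]

theorem mInner_add_single (A X : Matrix (Fin m) (Fin n) ℝ) (k : Fin m) (l : Fin n) (t : ℝ) :
    mInner A (X + Matrix.single k l t) = mInner A X + A k l * t := by
  simp only [mInner, Matrix.add_apply, mul_add, Finset.sum_add_distrib, Matrix.single_apply,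
    ite_and, mul_ite, mul_zero]
  simp

theorem nuclearNorm_add_single_le (X : Matrix (Fin m) (Fin n) ℝ) (k : Fin m) (l : Fin n)
    (t : ℝ) : nuclearNorm (X + Matrix.single k l t) ≤ nuclearNorm X + |t| := by
  refine csSup_le ⟨_, 0, spectralNorm_zero_le, rfl⟩ ?_
  rintro r ⟨Y, hY, rfl⟩
  rw [mInner_comm, mInner_add_single, mInner_comm]
  refine add_le_add (mInner_le_nuclearNorm X hY) ?_
  calc Y k l * t ≤ |Y k l| * |t| := (le_abs_self _).trans (abs_mul _ _).le
    _ ≤ 1 * |t| := by gcongr; exact (abs_apply_le_spectralNorm Y k l).trans hY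
    _ = |t| := one_mul _

theorem l1Norm_add_single (X : Matrix (Fin m) (Fin n) ℝ) (k : Fin m) (l : Fin n) (t : ℝ) :
    l1Norm (X + Matrix.single k l t) = l1Norm X + (|X k l + t| - |X k l|) := by
  have h : ∀ i j, |(X + Matrix.single k l t) i j|
      = |X i j| + if k = i then (if l = j then |X k l + t| - |X k l| else 0) else 0 := by
    intro i j
    rw [Matrix.add_apply, Matrix.single_apply, ite_and]
    split_ifs with hi hj
    · subst hi hj; ring
    · simp
    · simp
  simp only [l1Norm, h, Finset.sum_add_distrib]
  simp

theorem thetaNorm_add_single_le {θ : ℝ} (X : Matrix (Fin m) (Fin n) ℝ) (k : Fin m) (l : Fin n)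
    (t : ℝ) :
    thetaNorm θ (X + Matrix.single k l t)
      ≤ thetaNorm θ X + |t| + θ * (|X k l + t| - |X k l|) := by
  have h := nuclearNorm_add_single_le X k l t
  rw [thetaNorm, thetaNorm, l1Norm_add_single]
  linarith

theorem stmt13 (θ : ℝ) (hθ : 1 < θ) (A : Matrix (Fin m) (Fin n) ℝ)
    (hA0 : A ≠ 0) (hAnn : ∀ i j, 0 ≤ A i j)
    (X : Matrix (Fin m) (Fin n) ℝ) (hX : IsOptMax (thetaNorm θ) A X) :
    ∀ i j, 0 ≤ X i j := by
  intro i j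
  by_contra! hneg
  obtain ⟨k, l, hkl⟩ : ∃ k l, 0 < A k l := by
    by_contra! h
    exact hA0 (Matrix.ext fun k l => le_antisymm (h k l) (hAnn k l))
  -- Zeroing the negative entry leaves slack in the constraint, which is spent on a positive
  -- entry of `A`.
  set ε := (θ - 1) * (-X i j) / (1 + θ)
  have hε0 : 0 < ε := div_pos (mul_pos (by linarith) (by linarith)) (by linarith)
  have hεθ : ε * (1 + θ) = (θ - 1) * (-X i j) := div_mul_cancel₀ _ (by linarith)
  set Z := X + Matrix.single i j (-X i j)
  have hZ : thetaNorm θ Z ≤ thetaNorm θ X - (θ - 1) * (-X i j) := by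
    have h := thetaNorm_add_single_le (θ := θ) X i j (-X i j)
    rw [add_neg_cancel, abs_zero, abs_neg, abs_of_neg hneg] at h
    linarith
  have hfeas : thetaNorm θ (Z + Matrix.single k l ε) ≤ 1 := by
    have h := thetaNorm_add_single_le (θ := θ) Z k l ε
    rw [abs_of_pos hε0] at h
    have habs : |Z k l + ε| - |Z k l| ≤ ε := by
      have h' := abs_add_le (Z k l) ε
      rw [abs_of_pos hε0] at h'
      linarith
    have hmul := mul_le_mul_of_nonneg_left habs (by linarith : (0 : ℝ) ≤ θ)
    linarith [hX.1]
  have hopt := hX.2 _ hfeas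
  rw [mInner_add_single, mInner_add_single] at hopt
  linarith [mul_pos hkl hε0, mul_nonneg (hAnn i j) (neg_nonneg.2 hneg.le)]

end LAROS
end
end

section
/- Let A be a nonzero m×n real matrix and θ > 0. Suppose X = σ·u·vᵀ, with σ > 0, ‖u‖₂ = ‖v‖₂ = 1, u ≥ 0, v ≥ 0, is an optimal solution of the problem: maximize ⟨A,X⟩ subject to ‖X‖_θ ≤ 1. If indices i, j satisfy u_i > u_j = 0, then ‖A‖_θ* = (aᵢᵀv)/(θ‖v‖₁ + u_i) ≥ (aⱼᵀv)/(θ‖v‖₁), where aᵢ and aⱼ denote the i-th and j-th rows of A and ‖A‖_θ* is the optimal value of the problem. -/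
open scoped BigOperators

noncomputable section

namespace LAROS

variable {m n : ℕ}

theorem bddAbove_spectralNorm_set (Z : Matrix (Fin m) (Fin n) ℝ) :
    BddAbove {r | ∃ (u : Fin m → ℝ) (v : Fin n → ℝ),
      (∑ i, u i ^ 2) ≤ 1 ∧ (∑ j, v j ^ 2) ≤ 1 ∧ r = ∑ i, ∑ j, u i * Z i j * v j} := by
  have abs_le_one {l : ℕ} (w : Fin l → ℝ) (hw : ∑ i, w i ^ 2 ≤ 1) (i : Fin l) : |w i| ≤ 1 :=
    (sq_le_one_iff_abs_le_one _).1 <|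
      (Finset.single_le_sum (fun k _ => sq_nonneg (w k)) (Finset.mem_univ i)).trans hw
  refine ⟨∑ i, ∑ j, |Z i j|, ?_⟩
  rintro _ ⟨u, v, hu, hv, rfl⟩
  refine Finset.sum_le_sum fun i _ => Finset.sum_le_sum fun j _ => (le_abs_self _).trans ?_
  rw [abs_mul, abs_mul]
  calc |u i| * |Z i j| * |v j| ≤ 1 * |Z i j| * 1 := by
        gcongr
        exacts [abs_le_one u hu i, abs_le_one v hv j]
    _ = |Z i j| := by ring

theorem mInner_vecMulVec_le {x : Fin m → ℝ} {v : Fin n → ℝ} {r : ℝ} (hr : 0 < r)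
    (hx : ∑ i, x i ^ 2 ≤ r ^ 2) (hv : ∑ j, v j ^ 2 ≤ 1) {Z : Matrix (Fin m) (Fin n) ℝ}
    (hZ : spectralNorm Z ≤ 1) : mInner (Matrix.vecMulVec x v) Z ≤ r := by
  have hle : ∑ i, ∑ j, (x i / r) * Z i j * v j ≤ 1 := by
    refine (le_csSup (bddAbove_spectralNorm_set Z) ⟨fun i => x i / r, v, ?_, hv, rfl⟩).trans hZ
    simp only [div_pow, ← Finset.sum_div]
    exact (div_le_one (by positivity)).2 hx
  calc mInner (Matrix.vecMulVec x v) Z = r * ∑ i, ∑ j, (x i / r) * Z i j * v j := by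
        simp only [mInner, Matrix.vecMulVec_apply, Finset.mul_sum]
        refine Finset.sum_congr rfl fun i _ => Finset.sum_congr rfl fun j _ => ?_
        field_simp
    _ ≤ r := by nlinarith

theorem nuclearNorm_vecMulVec_le {x : Fin m → ℝ} {v : Fin n → ℝ} {r : ℝ} (hr : 0 < r)
    (hx : ∑ i, x i ^ 2 ≤ r ^ 2) (hv : ∑ j, v j ^ 2 ≤ 1) :
    nuclearNorm (Matrix.vecMulVec x v) ≤ r := by
  refine Real.sSup_le ?_ hr.le
  rintro _ ⟨Z, hZ, rfl⟩
  exact mInner_vecMulVec_le hr hx hv hZ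

theorem spectralNorm_vecMulVec_le_one {u : Fin m → ℝ} {v : Fin n → ℝ}
    (hu : ∑ i, u i ^ 2 ≤ 1) (hv : ∑ j, v j ^ 2 ≤ 1) :
    spectralNorm (Matrix.vecMulVec u v) ≤ 1 := by
  have inner_sq_le {l : ℕ} (a b : Fin l → ℝ) (ha : ∑ i, a i ^ 2 ≤ 1) (hb : ∑ i, b i ^ 2 ≤ 1) :
      |∑ i, a i * b i| ≤ 1 := by
    rw [← sq_le_one_iff_abs_le_one]
    exact (Finset.sum_mul_sq_le_sq_mul_sq _ a b).trans
      (mul_le_one₀ ha (Finset.sum_nonneg fun i _ => sq_nonneg _) hb)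
  refine Real.sSup_le ?_ zero_le_one
  rintro _ ⟨a, b, ha, hb, rfl⟩
  calc ∑ i, ∑ j, a i * Matrix.vecMulVec u v i j * b j
      = (∑ i, a i * u i) * ∑ j, v j * b j := by
        rw [Finset.sum_mul_sum]
        refine Finset.sum_congr rfl fun i _ => Finset.sum_congr rfl fun j _ => ?_
        rw [Matrix.vecMulVec_apply]
        ring
    _ ≤ |∑ i, a i * u i| * |∑ j, v j * b j| := (le_abs_self _).trans (abs_mul _ _).le
    _ ≤ 1 := mul_le_one₀ (inner_sq_le a u ha hu) (abs_nonneg _) (inner_sq_le v b hv hb)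

theorem le_nuclearNorm_smul_vecMulVec {u : Fin m → ℝ} {v : Fin n → ℝ} {σ : ℝ} (hσ : 0 < σ)
    (hu : ∑ i, u i ^ 2 = 1) (hv : ∑ j, v j ^ 2 = 1) :
    σ ≤ nuclearNorm (σ • Matrix.vecMulVec u v) := by
  refine le_csSup ⟨σ, ?_⟩ ⟨Matrix.vecMulVec u v, spectralNorm_vecMulVec_le_one hu.le hv.le, ?_⟩
  · rintro _ ⟨Z, hZ, rfl⟩
    rw [← Matrix.smul_vecMulVec]
    refine mInner_vecMulVec_le hσ ?_ hv.le hZ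
    simp [mul_pow, ← Finset.mul_sum, hu]
  · calc σ = σ * ((∑ i, u i ^ 2) * ∑ j, v j ^ 2) := by rw [hu, hv]; ring
      _ = _ := by
        rw [Finset.sum_mul_sum]
        simp only [mInner, Finset.mul_sum, Matrix.smul_apply, Matrix.vecMulVec_apply, smul_eq_mul]
        refine Finset.sum_congr rfl fun i _ => Finset.sum_congr rfl fun j _ => ?_
        ring

theorem l1Norm_vecMulVec (x : Fin m → ℝ) (v : Fin n → ℝ) :
    l1Norm (Matrix.vecMulVec x v) = (∑ i, |x i|) * ∑ j, |v j| := by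
  simp only [l1Norm, Matrix.vecMulVec_apply, abs_mul, Finset.sum_mul_sum]

theorem mInner_vecMulVec (A : Matrix (Fin m) (Fin n) ℝ) (x : Fin m → ℝ) (v : Fin n → ℝ) :
    mInner A (Matrix.vecMulVec x v) = ∑ i, x i * ∑ j, A i j * v j := by
  simp only [mInner, Matrix.vecMulVec_apply, Finset.mul_sum]
  refine Finset.sum_congr rfl fun i _ => Finset.sum_congr rfl fun j _ => ?_
  ring

/-- If `D` bounds `⟨A, ·⟩` on the unit ball of `‖·‖_θ`, it bounds `xᵀAv` by homogeneity. -/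
theorem sum_mul_le_of_bound {θ D : ℝ} (hθ : 0 < θ) {A : Matrix (Fin m) (Fin n) ℝ}
    (hD : ∀ Y, thetaNorm θ Y ≤ 1 → mInner A Y ≤ D) {x : Fin m → ℝ} {v : Fin n → ℝ} {r : ℝ}
    (hr : 0 < r) (hx : ∑ i, x i ^ 2 ≤ r ^ 2) (hv : ∑ j, v j ^ 2 ≤ 1) :
    ∑ i, x i * ∑ j, A i j * v j ≤ D * (r + θ * ((∑ i, |x i|) * ∑ j, |v j|)) := by
  set N := r + θ * ((∑ i, |x i|) * ∑ j, |v j|) with hN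
  have hNpos : 0 < N := by positivity
  have hfeas : thetaNorm θ (Matrix.vecMulVec (fun i => x i / N) v) ≤ 1 := by
    have hnuc : nuclearNorm (Matrix.vecMulVec (fun i => x i / N) v) ≤ r / N := by
      refine nuclearNorm_vecMulVec_le (by positivity) ?_ hv
      simp only [div_pow, ← Finset.sum_div]
      gcongr
    have hl1 : l1Norm (Matrix.vecMulVec (fun i => x i / N) v)
        = (∑ i, |x i|) / N * ∑ j, |v j| := by
      simp only [l1Norm_vecMulVec, abs_div, abs_of_pos hNpos, Finset.sum_div]
    calc thetaNorm θ (Matrix.vecMulVec (fun i => x i / N) v)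
        ≤ r / N + θ * ((∑ i, |x i|) / N * ∑ j, |v j|) := by
          rw [thetaNorm, hl1]
          gcongr
      _ = N / N := by rw [hN]; ring
      _ = 1 := div_self hNpos.ne'
  have hle := hD _ hfeas
  simp only [mInner_vecMulVec, div_mul_eq_mul_div, ← Finset.sum_div] at hle
  exact (div_le_iff₀ hNpos).1 hle

/-- First-order comparison at the optimum when the `k`-th entry of `u` is perturbed by `t`. -/
theorem perturb_le_of_isOptMax {θ σ : ℝ} (hθ : 0 < θ) {A : Matrix (Fin m) (Fin n) ℝ}
    {u : Fin m → ℝ} {v : Fin n → ℝ} (hσ : 0 < σ)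
    (hu2 : ∑ i, u i ^ 2 = 1) (hv2 : ∑ j, v j ^ 2 = 1) (hu0 : ∀ i, 0 ≤ u i)
    (hopt : IsOptMax (thetaNorm θ) A (σ • Matrix.vecMulVec u v))
    (k : Fin m) {t : ℝ} (ht : 0 ≤ u k + t) :
    t * ∑ l, A k l * v l ≤ mInner A (σ • Matrix.vecMulVec u v) *
      (t * u k + t ^ 2 / 2 + θ * (t * ∑ l, |v l|)) := by
  obtain ⟨hfeas, hmax⟩ := hopt
  set D := mInner A (σ • Matrix.vecMulVec u v) with hDdef
  have hD0 : 0 ≤ D := by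
    have h := sum_mul_le_of_bound hθ hmax (x := 0) (v := 0) one_pos (by simp) (by simp)
    simpa using h
  have hD : D = σ * ∑ i, u i * ∑ l, A i l * v l := by
    rw [hDdef, ← Matrix.smul_vecMulVec, mInner_vecMulVec, Finset.mul_sum]
    exact Finset.sum_congr rfl fun i _ => by simp [mul_assoc]
  have hnorm : σ * (1 + θ * ((∑ i, |u i|) * ∑ l, |v l|)) ≤ 1 := by
    have hl1 : l1Norm (σ • Matrix.vecMulVec u v) = σ * ((∑ i, |u i|) * ∑ l, |v l|) := by
      rw [← Matrix.smul_vecMulVec, l1Norm_vecMulVec]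
      simp [abs_mul, abs_of_pos hσ, ← Finset.mul_sum, mul_assoc]
    have hnuc := le_nuclearNorm_smul_vecMulVec hσ hu2 hv2
    rw [thetaNorm, hl1] at hfeas
    linarith
  have hcur : D * (1 + θ * ((∑ i, |u i|) * ∑ l, |v l|)) ≤ ∑ i, u i * ∑ l, A i l * v l := by
    refine le_of_mul_le_mul_left ?_ hσ
    rw [← hD]
    calc σ * (D * (1 + θ * ((∑ i, |u i|) * ∑ l, |v l|)))
        = D * (σ * (1 + θ * ((∑ i, |u i|) * ∑ l, |v l|))) := by ring
      _ ≤ D := mul_le_of_le_one_right hD0 hnorm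
  set x : Fin m → ℝ := u + Pi.single k t with hx
  have hxsq : ∑ i, x i ^ 2 = 1 + 2 * t * u k + t ^ 2 := by
    have hterm (i : Fin m) : x i ^ 2 = u i ^ 2 + (Pi.single k (2 * t * u k + t ^ 2) : Fin m → ℝ) i := by
      by_cases h : i = k
      · subst h
        simp [hx]
        ring
      · simp [hx, h]
    simp [hterm, Finset.sum_add_distrib, hu2, add_assoc]
  have hxabs : ∑ i, |x i| = (∑ i, |u i|) + t := by
    have hterm (i : Fin m) : |x i| = |u i| + (Pi.single k t : Fin m → ℝ) i := by
      by_cases h : i = k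
      · subst h
        simp [hx, abs_of_nonneg ht, abs_of_nonneg (hu0 i)]
      · simp [hx, h]
    simp [hterm, Finset.sum_add_distrib]
  have hxA : ∑ i, x i * ∑ l, A i l * v l
      = (∑ i, u i * ∑ l, A i l * v l) + t * ∑ l, A k l * v l := by
    simp [hx, add_mul, Finset.sum_add_distrib, Pi.single_apply]
  have hsq0 : 0 ≤ ∑ i, x i ^ 2 := Finset.sum_nonneg fun i _ => sq_nonneg _
  have hpert := sum_mul_le_of_bound hθ hmax (x := x) (v := v) (r := 1 + t * u k + t ^ 2 / 2)
    (by linarith) (by rw [hxsq]; nlinarith [sq_nonneg (t * u k + t ^ 2 / 2)]) hv2.le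
  rw [hxA, hxabs] at hpert
  linarith

/-- A linear function dominated by a vanishing quadratic correction on `(0, ε]` is nonpositive. -/
theorem nonpos_of_le_mul {c D ε : ℝ} (hε : 0 < ε)
    (h : ∀ t, 0 < t → t ≤ ε → c ≤ D * t) : c ≤ 0 := by
  by_contra! hc
  have hD : 0 < D := pos_of_mul_pos_left (hc.trans_le (h ε hε le_rfl)) hε.le
  have ht := h (min ε (c / (2 * D))) (by positivity) (min_le_left _ _)
  have hle : D * min ε (c / (2 * D)) ≤ D * (c / (2 * D)) := by
    gcongr
    exact min_le_right _ _
  have heq : D * (c / (2 * D)) = c / 2 := by field_simp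
  linarith

theorem stmt14 (θ : ℝ) (hθ : 0 < θ) (A : Matrix (Fin m) (Fin n) ℝ) (hA : A ≠ 0)
    (σ : ℝ) (u : Fin m → ℝ) (v : Fin n → ℝ) (hσ : 0 < σ)
    (hu2 : (∑ i, u i ^ 2) = 1) (hv2 : (∑ j, v j ^ 2) = 1)
    (hu0 : ∀ i, 0 ≤ u i) (hv0 : ∀ j, 0 ≤ v j)
    (hopt : IsOptMax (thetaNorm θ) A (σ • Matrix.vecMulVec u v))
    (i j : Fin m) (hui : 0 < u i) (huj : u j = 0) :
    dualNorm (thetaNorm θ) A = (∑ k, A i k * v k) / (θ * (∑ k, |v k|) + u i) ∧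
      (∑ k, A j k * v k) / (θ * (∑ k, |v k|)) ≤ dualNorm (thetaNorm θ) A := by
  have hpert := fun k {t : ℝ} => perturb_le_of_isOptMax (t := t) hθ hσ hu2 hv2 hu0 hopt k
  have hdual : dualNorm (thetaNorm θ) A = mInner A (σ • Matrix.vecMulVec u v) := by
    refine IsGreatest.csSup_eq ⟨⟨_, hopt.1, rfl⟩, ?_⟩
    rintro _ ⟨Y, hY, rfl⟩
    exact hopt.2 Y hY
  rw [hdual]
  set D := mInner A (σ • Matrix.vecMulVec u v)
  have hvpos : 0 < ∑ k, |v k| := by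
    refine (Finset.sum_nonneg fun k _ => abs_nonneg (v k)).lt_of_ne' fun h => ?_
    have hv : ∀ k, v k = 0 := by
      simpa [Finset.sum_eq_zero_iff_of_nonneg, abs_nonneg] using h
    simp [hv] at hv2
  have hup (k : Fin m) : ∑ l, A k l * v l ≤ D * (u k + θ * ∑ l, |v l|) := by
    refine sub_nonpos.1 (nonpos_of_le_mul (D := D / 2) one_pos fun t ht _ => ?_)
    refine le_of_mul_le_mul_left ?_ ht
    linarith [hpert k (t := t) (by linarith [hu0 k])]
  have hlow : D * (u i + θ * ∑ l, |v l|) ≤ ∑ l, A i l * v l := by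
    refine sub_nonpos.1 (nonpos_of_le_mul (D := D / 2) hui fun t ht hti => ?_)
    refine le_of_mul_le_mul_left ?_ ht
    linarith [hpert i (t := -t) (by linarith)]
  constructor
  · rw [eq_div_iff (by positivity)]
    linarith [hup i]
  · rw [div_le_iff₀ (by positivity)]
    have hj := hup j
    rwa [huj, zero_add] at hj

end LAROS
end
end
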